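/- Let N be a positive odd integer and let ε be a real number with 0 ≤ ε < 1/2. Then Σ_{c=0}^{⌊N/2⌋} C(N, c) (1 − ε)^c ε^{N − c} ≤ exp(−2N(1/2 − ε)²), where C(N, c) denotes the binomial coefficient. -/

import Mathlib

open Finset

/-- A product `p ^ c * q ^ (2m+1-c)` with `c ≤ m` and `q ≤ p` is largest when `c = m`. -/
theorem pow_mul_pow_le_mul_pow_mul {p q : ℝ} (hq : 0 ≤ q) (hqp : q ≤ p) {m c : ℕ} (hc : c ≤ m) :
    p ^ c * q ^ (2 * m + 1 - c) ≤ (p * q) ^ m * q := by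
  obtain ⟨k, rfl⟩ := Nat.exists_eq_add_of_le hc
  have hp : 0 ≤ p := hq.trans hqp
  calc p ^ c * q ^ (2 * (c + k) + 1 - c)
      = p ^ c * q ^ (c + k + 1) * q ^ k := by
        rw [show 2 * (c + k) + 1 - c = c + k + 1 + k by omega]
        ring
    _ ≤ p ^ c * q ^ (c + k + 1) * p ^ k := by gcongr
    _ = (p * q) ^ (c + k) * q := by ring

/-- For `N` a positive odd integer and `0 ≤ ε < 1/2`, the Binomial(`N`, `1 - ε`) CDF at
`⌊N/2⌋` satisfies `∑_{c=0}^{⌊N/2⌋} C(N,c) (1-ε)^c ε^(N-c) ≤ exp (-2 N (1/2 - ε)^2)`. -/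
theorem binomial_cdf_le_exp
    (N : ℕ) (hN : 0 < N) (hodd : Odd N)
    (ε : ℝ) (hε0 : 0 ≤ ε) (hε : ε < 1 / 2) :
    (∑ c ∈ Finset.range (N / 2 + 1),
        (N.choose c : ℝ) * (1 - ε) ^ c * ε ^ (N - c))
      ≤ Real.exp (-2 * N * (1 / 2 - ε) ^ 2) := by
  obtain ⟨m, rfl⟩ := hodd
  rw [show (2 * m + 1) / 2 = m by omega]
  have hsum : ∑ c ∈ Finset.range (m + 1), ((2 * m + 1).choose c : ℝ) = 4 ^ m := by
    exact_mod_cast Nat.sum_range_choose_halfway m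
  have hpq : 4 * ((1 - ε) * ε) ≤ Real.exp (-4 * (1 / 2 - ε) ^ 2) := by
    linarith [Real.add_one_le_exp (-4 * (1 / 2 - ε) ^ 2)]
  have hq : ε ≤ Real.exp (-2 * (1 / 2 - ε) ^ 2) := by
    nlinarith [Real.add_one_le_exp (-2 * (1 / 2 - ε) ^ 2)]
  have hnonneg : 0 ≤ 4 * ((1 - ε) * ε) := by nlinarith
  calc ∑ c ∈ Finset.range (m + 1),
        ((2 * m + 1).choose c : ℝ) * (1 - ε) ^ c * ε ^ (2 * m + 1 - c)
      ≤ ∑ c ∈ Finset.range (m + 1),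
        ((2 * m + 1).choose c : ℝ) * (((1 - ε) * ε) ^ m * ε) := by
        refine Finset.sum_le_sum fun c hc => ?_
        rw [mul_assoc]
        exact mul_le_mul_of_nonneg_left
          (pow_mul_pow_le_mul_pow_mul hε0 (by linarith)
            (Nat.lt_succ_iff.mp (Finset.mem_range.mp hc))) (Nat.cast_nonneg _)
    _ = (4 * ((1 - ε) * ε)) ^ m * ε := by
        rw [← Finset.sum_mul, hsum, mul_pow 4]
        ring
    _ ≤ Real.exp (-4 * (1 / 2 - ε) ^ 2) ^ m * Real.exp (-2 * (1 / 2 - ε) ^ 2) := by gcongr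
    _ = Real.exp (-2 * (2 * m + 1 : ℕ) * (1 / 2 - ε) ^ 2) := by
        rw [← Real.exp_nat_mul, ← Real.exp_add]
        push_cast
        ring_nf
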